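/- Let ν ∈ (0,1/2], a ∈ (0, 1/2 − ν], c(a) = 1/2 − a, δ = √(c(a)² − ν²), λ = δ/c(a), and define for x ≠ 0 (with z = x₁ + i x₂): φ(x) = |x|^{δ−1/2} e^{−(ν/c(a))|x|} and χ(x) = i (z/|z|) √((1−λ)/(1+λ)) |x|^{δ−1/2} e^{−(ν/c(a))|x|}. Then for every x ∈ ℝ²∖{0}: D_a χ(x) + (1 − λ − ν/|x|) φ(x) = 0 and D_a^* φ(x) − (1 + λ + ν/|x|) χ(x) = 0; i.e., the spinor ψ = (φ,χ)ᵀ is a pointwise solution of the eigenvalue equation H_{ν,a} ψ = λ ψ for the two-dimensional magnetic Dirac-Coulomb operator, with eigenvalue λ = λ_{ν,a}. -/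

import Mathlib

open MeasureTheory

/-- The Wirtinger derivative `∂_z η = (1/2)(∂₁ η - i ∂₂ η)`, identifying `ℝ²` with `ℂ`. -/
noncomputable def wirtingerZ (η : ℂ → ℂ) (x : ℂ) : ℂ :=
  (1/2 : ℂ) * (fderiv ℝ η x 1 - Complex.I * fderiv ℝ η x Complex.I)

/-- The Wirtinger derivative `∂_{z̄} η = (1/2)(∂₁ η + i ∂₂ η)`, identifying `ℝ²` with `ℂ`. -/
noncomputable def wirtingerZbar (η : ℂ → ℂ) (x : ℂ) : ℂ :=
  (1/2 : ℂ) * (fderiv ℝ η x 1 + Complex.I * fderiv ℝ η x Complex.I)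

/-- The magnetic operator `D_a χ = -2i ∂_z χ + i a (z̄/|z|²) χ`. -/
noncomputable def Dop (a : ℝ) (χ : ℂ → ℂ) (x : ℂ) : ℂ :=
  (-2) * Complex.I * wirtingerZ χ x
    + Complex.I * (a : ℂ) * ((starRingEnd ℂ) x / ((‖x‖ : ℂ)^2)) * χ x

/-- The magnetic operator `D_a^* φ = -2i ∂_{z̄} φ - i a (z/|z|²) φ`. -/
noncomputable def DopStar (a : ℝ) (φ : ℂ → ℂ) (x : ℂ) : ℂ :=
  (-2) * Complex.I * wirtingerZbar φ x
    - Complex.I * (a : ℂ) * (x / ((‖x‖ : ℂ)^2)) * φ x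

/-- The real Fréchet derivative of a radial function, at a point other than the origin. -/
theorem hasFDerivAt_radial {g : ℝ → ℝ} {g' : ℝ} {x : ℂ} (hx : x ≠ 0)
    (hg : HasDerivAt g g' ‖x‖) :
    HasFDerivAt (fun y : ℂ => ((g ‖y‖ : ℝ) : ℂ))
      (Complex.ofRealCLM.comp (g' • (‖x‖⁻¹ • innerSL ℝ x))) x := by
  have hsq : HasFDerivAt (fun y : ℂ => ‖y‖ ^ 2) (2 • innerSL ℝ x) x :=
    (hasStrictFDerivAt_norm_sq x).hasFDerivAt
  have hr : 0 < ‖x‖ := norm_pos_iff.mpr hx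
  have hnorm : HasFDerivAt (fun y : ℂ => ‖y‖) (‖x‖⁻¹ • innerSL ℝ x) x := by
    have h := hsq.sqrt (by positivity)
    simp only [Real.sqrt_sq (norm_nonneg _)] at h
    refine h.congr_fderiv ?_
    ext v
    simp
    field_simp
  exact Complex.ofRealCLM.hasFDerivAt.comp x (hg.comp_hasFDerivAt x hnorm)

/-- For radial `g`, `∂_{z̄} g = (z / 2|z|) g'`. -/
theorem wirtingerZbar_radial {g : ℝ → ℝ} {g' : ℝ} {x : ℂ} (hx : x ≠ 0)
    (hg : HasDerivAt g g' ‖x‖) :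
    wirtingerZbar (fun y : ℂ => ((g ‖y‖ : ℝ) : ℂ)) x = x / (2 * (‖x‖ : ℂ)) * (g' : ℂ) := by
  rw [wirtingerZbar, (hasFDerivAt_radial hx hg).fderiv]
  have hr : (‖x‖ : ℂ) ≠ 0 := by simpa using hx
  simp [Complex.inner]
  field_simp
  linear_combination (g' : ℂ) * Complex.re_add_im x

/-- For radial `g` and a constant `k`, `∂_z (z k g) = k (g + (|z| / 2) g')`. -/
theorem wirtingerZ_mul_radial {g : ℝ → ℝ} {g' : ℝ} {x : ℂ} (k : ℂ) (hx : x ≠ 0)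
    (hg : HasDerivAt g g' ‖x‖) :
    wirtingerZ (fun y : ℂ => y * (k * ((g ‖y‖ : ℝ) : ℂ))) x =
      k * ((g ‖x‖ : ℂ) + (‖x‖ : ℂ) / 2 * (g' : ℂ)) := by
  have h := (hasFDerivAt_id (𝕜 := ℝ) x).mul ((hasFDerivAt_radial hx hg).const_mul k)
  have hr : (‖x‖ : ℂ) ≠ 0 := by simpa using hx
  have hsq : (‖x‖ : ℂ) ^ 2 = (x.re : ℂ) ^ 2 + (x.im : ℂ) ^ 2 := by
    rw [← Complex.ofReal_pow, Complex.sq_norm, Complex.normSq_apply]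
    push_cast
    ring
  have hfd : fderiv ℝ (fun y : ℂ => y * (k * ((g ‖y‖ : ℝ) : ℂ))) x = _ := h.fderiv
  rw [wirtingerZ, hfd]
  simp [Complex.inner]
  field_simp
  linear_combination -k * (g' : ℂ) * ((x.re : ℂ) - Complex.I * x.im) * Complex.re_add_im x
    - k * (g' : ℂ) * hsq
    - (k * (‖x‖ : ℂ) * (g ‖x‖ : ℂ) + k * (g' : ℂ) * (x.im : ℂ) ^ 2) * Complex.I_sq

/-- The derivative of the radial profile `r ^ p * exp (-m r)`. -/
theorem hasDerivAt_rpow_mul_exp (p m : ℝ) {r : ℝ} (hr : 0 < r) :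
    HasDerivAt (fun t : ℝ => t ^ p * Real.exp (-m * t))
      ((p / r - m) * (r ^ p * Real.exp (-m * r))) r := by
  have h1 := Real.hasDerivAt_rpow_const (x := r) (p := p) (Or.inl hr.ne')
  have h2 := ((hasDerivAt_id r).const_mul (-m)).exp
  refine (h1.mul h2).congr_deriv ?_
  rw [Real.rpow_sub_one hr.ne']
  simp only [id]
  ring

theorem stmt15 (ν a : ℝ) (hν : ν ∈ Set.Ioc (0 : ℝ) (1/2)) (ha : a ∈ Set.Ioc (0 : ℝ) (1/2 - ν))
    (c δ lam : ℝ) (hc : c = 1/2 - a) (hδ : δ = Real.sqrt (c^2 - ν^2)) (hlam : lam = δ / c)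
    (φ χ : ℂ → ℂ)
    (hφ : ∀ x : ℂ, φ x = ((‖x‖ ^ (δ - 1/2) * Real.exp (-(ν/c) * ‖x‖) : ℝ) : ℂ))
    (hχ : ∀ x : ℂ, χ x = Complex.I * (x / (‖x‖ : ℂ)) *
      ((Real.sqrt ((1 - lam)/(1 + lam)) : ℝ) : ℂ) *
      ((‖x‖ ^ (δ - 1/2) * Real.exp (-(ν/c) * ‖x‖) : ℝ) : ℂ)) :
    ∀ x : ℂ, x ≠ 0 →
      Dop a χ x + ((1 - lam - ν/‖x‖ : ℝ) : ℂ) * φ x = 0 ∧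
      DopStar a φ x - ((1 + lam + ν/‖x‖ : ℝ) : ℂ) * χ x = 0 := by
  obtain ⟨hν0, -⟩ := hν
  obtain ⟨-, ha⟩ := ha
  have hνc : ν ≤ c := by linarith
  have hc0 : 0 < c := by linarith
  have hδ0 : 0 ≤ δ := hδ ▸ Real.sqrt_nonneg _
  have hδsq : δ ^ 2 = c ^ 2 - ν ^ 2 := by
    rw [hδ, Real.sq_sqrt]
    nlinarith
  have hδc : δ ≤ c := by nlinarith
  have hκ : Real.sqrt ((1 - lam) / (1 + lam)) = (c - δ) / ν := by
    have hfrac : (1 - lam) / (1 + lam) = ((c - δ) / ν) ^ 2 := by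
      have : 1 + lam ≠ 0 := by
        rw [hlam]
        positivity
      rw [div_eq_iff this, hlam]
      field_simp
      linear_combination (c - δ) * hδsq
    rw [hfrac, Real.sqrt_sq (div_nonneg (by linarith) hν0.le)]
  intro x hx
  have hr : 0 < ‖x‖ := norm_pos_iff.mpr hx
  have hrC : (‖x‖ : ℂ) ≠ 0 := by exact_mod_cast hr.ne'
  have hνC : (ν : ℂ) ≠ 0 := by exact_mod_cast hν0.ne'
  have hcC : (c : ℂ) ≠ 0 := by exact_mod_cast hc0.ne'
  have hδC : (δ : ℂ) ^ 2 = (c : ℂ) ^ 2 - (ν : ℂ) ^ 2 := by exact_mod_cast hδsq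
  have haC : (a : ℂ) = 1 / 2 - (c : ℂ) := by
    rw [hc]
    push_cast
    ring
  have hxx : x * (starRingEnd ℂ) x = (‖x‖ : ℂ) ^ 2 := Complex.mul_conj' x
  set g : ℝ → ℝ := fun t => t ^ (δ - 1 / 2) * Real.exp (-(ν / c) * t) with hgdef
  have hg : HasDerivAt g (((δ - 1 / 2) / ‖x‖ - ν / c) * g ‖x‖) ‖x‖ :=
    hasDerivAt_rpow_mul_exp _ _ hr
  have hφ' : φ = fun y : ℂ => ((g ‖y‖ : ℝ) : ℂ) := funext hφ
  have hχ' : χ = fun y : ℂ =>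
      y * (Complex.I * (((c - δ) / ν : ℝ) : ℂ) * (((fun t => g t / t) ‖y‖ : ℝ) : ℂ)) := by
    funext y
    rw [hχ, hκ]
    simp only [hgdef]
    push_cast
    ring
  have hgr : HasDerivAt (fun t => g t / t)
      ((((δ - 1 / 2) / ‖x‖ - ν / c) * g ‖x‖ * ‖x‖ - g ‖x‖ * 1) / ‖x‖ ^ 2) ‖x‖ :=
    hg.div (hasDerivAt_id _) hr.ne'
  constructor
  · rw [Dop, hχ', wirtingerZ_mul_radial _ hx hgr, hφ', hlam]
    push_cast
    generalize (g ‖x‖ : ℂ) = G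
    have : (starRingEnd ℂ) x = (‖x‖ : ℂ) ^ 2 / x := by
      rw [← hxx]
      field_simp
    rw [this, haC]
    field_simp
    ring_nf
    simp only [Complex.I_sq, hδC]
    ring
  · rw [DopStar, hφ', wirtingerZbar_radial hx hg, hχ', hlam]
    push_cast
    generalize (g ‖x‖ : ℂ) = G
    rw [haC]
    field_simp
    ring_nf
    simp only [hδC]
    ring
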